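/- The quotient of A by the linear span of commutators is A/[A,A] = R ⊕ span{b^i : i odd, 1 ≤ i ≤ 2n−1}; in particular, the odd powers of the loop b give a basis of A/([A,A]+R), and this space has one basis element in each odd degree ≤ 2n−1. -/

import Mathlib

/-!
STATEMENT 6. Let `A = Π_{T_n}` be the preprojective algebra of the quiver of type `T_n`
(vertices `0, …, n-1`, arrows `a i : i → i+1`, their reversals, and a loop `b` at the last
vertex, modulo the preprojective relation `∑ [a, a*] = b²`), graded with arrows in degree 1.
`R = ⊕ ℂ eᵢ` is the span of the vertex idempotents and `[A,A]` is the linear span of all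
commutators.

Claim: `A/[A,A] = R ⊕ span{bⁱ : i odd, 1 ≤ i ≤ 2n-1}`; in particular the odd powers of the
loop `b` give a basis of `A/([A,A]+R)`, one in each odd degree `≤ 2n-1`.
-/

inductive TGen (n : ℕ) : Type
  | e : Fin n → TGen n
  | a : Fin n → TGen n
  | astar : Fin n → TGen n
  | b : TGen n

namespace TPre

open FreeAlgebra

abbrev F (n : ℕ) := FreeAlgebra ℂ (TGen n)

def g {n : ℕ} (x : TGen n) : F n := FreeAlgebra.ι ℂ x

/-- The defining relations of the preprojective algebra `Π_{T_n}`. -/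
inductive TRel (n : ℕ) : F n → F n → Prop
  | idem (i j : Fin n) : TRel n (g (.e i) * g (.e j)) (if i = j then g (.e i) else 0)
  | sum_idem : TRel n (∑ i : Fin n, g (.e i)) 1
  | a_path (i : Fin n) (h : (i : ℕ) + 1 < n) :
      TRel n (g (.e ⟨(i : ℕ) + 1, h⟩) * g (.a i) * g (.e i)) (g (.a i))
  | a_junk (i : Fin n) (h : ¬ (i : ℕ) + 1 < n) : TRel n (g (.a i)) 0
  | astar_path (i : Fin n) (h : (i : ℕ) + 1 < n) :
      TRel n (g (.e i) * g (.astar i) * g (.e ⟨(i : ℕ) + 1, h⟩)) (g (.astar i))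
  | astar_junk (i : Fin n) (h : ¬ (i : ℕ) + 1 < n) : TRel n (g (.astar i)) 0
  | b_path (i : Fin n) (h : (i : ℕ) + 1 = n) :
      TRel n (g (.e i) * g .b * g (.e i)) (g .b)
  | preproj :
      TRel n (∑ i : Fin n, (g (.a i) * g (.astar i) - g (.astar i) * g (.a i)))
        (g .b * g .b)

/-- The preprojective algebra `A = Π_{T_n}` over `ℂ`. -/
abbrev PiT (n : ℕ) := RingQuot (TRel n)

def gen {n : ℕ} (x : TGen n) : PiT n := RingQuot.mkAlgHom ℂ (TRel n) (g x)

/-- `[A,A]`: the linear span of all commutators `xy - yx`. -/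
def commSpan (n : ℕ) : Submodule ℂ (PiT n) :=
  Submodule.span ℂ {x | ∃ y z : PiT n, x = y * z - z * y}

/-- `R`: the span of the vertex idempotents. -/
def Rspan (n : ℕ) : Submodule ℂ (PiT n) :=
  Submodule.span ℂ (Set.range fun i : Fin n => gen (TGen.e i))

/-- The family consisting of the classes in `A/[A,A]` of the vertex idempotents `eᵢ`
and of the odd powers `b, b³, …, b^{2n-1}` of the loop. -/
def abFamily (n : ℕ) : Fin n ⊕ Fin n → PiT n ⧸ commSpan n
  | .inl i => Submodule.Quotient.mk (gen (TGen.e i))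
  | .inr j => Submodule.Quotient.mk ((gen TGen.b) ^ (2 * (j : ℕ) + 1))

/-- The family of classes of the odd powers `b, b³, …, b^{2n-1}` in `A/([A,A]+R)`. -/
def abFamily' (n : ℕ) : Fin n → PiT n ⧸ (commSpan n ⊔ Rspan n) :=
  fun j => Submodule.Quotient.mk ((gen TGen.b) ^ (2 * (j : ℕ) + 1))

end TPre

open TPre

/-- The abstract relations used for the spanning argument. -/
structure TAbs {A : Type*} [Ring A] (n : ℕ) (e : ℕ → A) (X Y b : A) : Prop where
  hX0 : e 0 * X = 0
  hX : ∀ i, e (i+1) * X = X * e i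
  hY0 : Y * e 0 = 0
  hY : ∀ i, Y * e (i+1) = e i * Y
  hb : ∀ i, b * e i = if i + 1 = n then b else 0
  hb' : ∀ i, e i * b = if i + 1 = n then b else 0
  hee : ∀ i j, e i * e j = if i = j then e i else 0
  hen : ∀ i, n ≤ i → e i = 0
  hs : ∑ i ∈ Finset.range n, e i = 1
  hp : X * Y - Y * X = b * b

namespace TAbs

variable {A : Type*} [Ring A] {n : ℕ} {e : ℕ → A} {X Y b : A}

theorem last (h : TAbs n e X Y b) (hn : 1 ≤ n) : b * e (n-1) = b ∧ e (n-1) * b = b := by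
  rw [h.hb, h.hb', if_pos (by omega)]; exact ⟨rfl, rfl⟩

theorem Xlast (h : TAbs n e X Y b) (hn : 1 ≤ n) : X * e (n-1) = 0 := by
  rw [← h.hX, h.hen _ (by omega), zero_mul]

theorem lastY (h : TAbs n e X Y b) (hn : 1 ≤ n) : e (n-1) * Y = 0 := by
  rw [← h.hY, h.hen _ (by omega), mul_zero]

theorem Xb (h : TAbs n e X Y b) (hn : 1 ≤ n) : X * b = 0 := by
  rw [← (h.last hn).2, ← mul_assoc, h.Xlast hn, zero_mul]

theorem bY (h : TAbs n e X Y b) (hn : 1 ≤ n) : b * Y = 0 := by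
  rw [← (h.last hn).1, mul_assoc, h.lastY hn, mul_zero]

theorem YX (h : TAbs n e X Y b) : Y * X = X * Y - b * b := by
  rw [← h.hp]; abel

theorem zX (h : TAbs n e X Y b) (hn : 1 ≤ n) : Commute (X * Y) X := by
  show X * Y * X = X * (X * Y)
  rw [mul_assoc, h.YX, mul_sub, ← mul_assoc X b b, h.Xb hn]; simp

theorem zY (h : TAbs n e X Y b) (hn : 1 ≤ n) : Commute (X * Y) Y := by
  show X * Y * Y = Y * (X * Y)
  rw [← mul_assoc Y, h.YX, sub_mul, mul_assoc b b Y, h.bY hn]; simp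

theorem zb_eq (h : TAbs n e X Y b) (hn : 1 ≤ n) : X * Y * b = b * b * b := by
  rw [← h.hp, sub_mul, mul_assoc Y, h.Xb hn]; simp

theorem bz_eq (h : TAbs n e X Y b) (hn : 1 ≤ n) : b * (X * Y) = b * b * b := by
  rw [mul_assoc b b, ← h.hp, mul_sub, ← mul_assoc b Y, h.bY hn]; simp

theorem zb (h : TAbs n e X Y b) (hn : 1 ≤ n) : Commute (X * Y) b := by
  show _ = _
  rw [h.zb_eq hn, h.bz_eq hn]

theorem ze (h : TAbs n e X Y b) (i : ℕ) : Commute (X * Y) (e i) := by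
  show _ = _
  cases i with
  | zero => rw [mul_assoc, h.hY0, ← mul_assoc, h.hX0]; simp
  | succ i => rw [mul_assoc, h.hY, ← mul_assoc, ← h.hX, mul_assoc]

theorem bb (h : TAbs n e X Y b) (hn : 1 ≤ n) : b * b = e (n-1) * (X * Y) := by
  have h1 : b * b = b * b * e (n-1) := by rw [mul_assoc, (h.last hn).1]
  rw [h1, ← h.hp, sub_mul, mul_assoc Y, h.Xlast hn, mul_zero, sub_zero]
  exact h.ze _

theorem z0 (h : TAbs n e X Y b) : e 0 * (X * Y) = 0 := by
  rw [← mul_assoc, h.hX0, zero_mul]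

theorem zpow_zero (h : TAbs n e X Y b) (hn : 1 ≤ n) (i : ℕ) : e i * (X * Y) ^ (i+1) = 0 := by
  induction i with
  | zero => simpa using h.z0
  | succ i ih =>
    rw [pow_succ', ← mul_assoc, ← mul_assoc, h.hX, mul_assoc X, mul_assoc X,
      mul_assoc, ((h.zY hn).pow_left _).symm.eq, ← mul_assoc (e i), ih]; simp

theorem zn (h : TAbs n e X Y b) (hn : 1 ≤ n) : (X * Y) ^ n = 0 := by
  rw [← one_mul ((X*Y)^n), ← h.hs, Finset.sum_mul]
  refine Finset.sum_eq_zero fun i hi => ?_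
  rw [Finset.mem_range] at hi
  obtain ⟨k, rfl⟩ : ∃ k, n = (i+1) + k := ⟨n - (i+1), by omega⟩
  rw [pow_add, ← mul_assoc, h.zpow_zero hn, zero_mul]

theorem bodd (h : TAbs n e X Y b) (hn : 1 ≤ n) (k : ℕ) : b ^ (2*k+1) = b * (X * Y) ^ k := by
  induction k with
  | zero => simp
  | succ k ih =>
    rw [show 2*(k+1)+1 = 2 + (2*k+1) by ring, pow_add, ih, pow_two, pow_succ' (X * Y) k,
      ← mul_assoc, ← mul_assoc b, h.bz_eq hn]

theorem XpYp (h : TAbs n e X Y b) (hn : 1 ≤ n) (p : ℕ) : X ^ p * Y ^ p = (X * Y) ^ p := by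
  induction p with
  | zero => simp
  | succ p ih =>
    rw [pow_succ' Y, pow_succ X, mul_assoc, ← mul_assoc X Y, ((h.zY hn).pow_right p).eq,
      ← mul_assoc, ih, pow_succ]

variable [Algebra ℂ A]

/-- Spanning set of normal forms. -/
def NF (n : ℕ) (e : ℕ → A) (X Y b : A) : Set A :=
  {x | (∃ i k p, x = e i * (X * Y) ^ k * X ^ p) ∨ (∃ i k p, x = e i * (X * Y) ^ k * Y ^ p) ∨
    (∃ i k p q, x = e i * (X * Y) ^ k * (Y ^ p * b * X ^ q))}

theorem nf_step {g : A} {S : Set A} (H : ∀ x ∈ S, g * x ∈ Submodule.span ℂ S) :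
    ∀ x ∈ Submodule.span ℂ S, g * x ∈ Submodule.span ℂ S := by
  intro x hx
  have : Submodule.span ℂ S ≤ (Submodule.span ℂ S).comap (LinearMap.mulLeft ℂ g) :=
    Submodule.span_le.2 H
  exact this hx

theorem nf_e (h : TAbs n e X Y b) (j : ℕ) : ∀ x ∈ Submodule.span ℂ (NF n e X Y b),
    e j * x ∈ Submodule.span ℂ (NF n e X Y b) := by
  refine nf_step fun x hx => ?_
  have key : ∀ i w, e i * w ∈ NF n e X Y b → e j * (e i * w) ∈ Submodule.span ℂ (NF n e X Y b) := by
    intro i w hw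
    rw [← mul_assoc, h.hee]
    split_ifs with hij
    · subst hij; exact Submodule.subset_span hw
    · simp
  rcases id hx with ⟨i, k, p, rfl⟩ | ⟨i, k, p, rfl⟩ | ⟨i, k, p, q, rfl⟩ <;>
  · rw [mul_assoc] at hx ⊢
    exact key _ _ hx

theorem nf1 (i k p : ℕ) : e i * ((X * Y) ^ k * X ^ p) ∈ Submodule.span ℂ (NF n e X Y b) :=
  Submodule.subset_span (Or.inl ⟨i, k, p, by rw [mul_assoc]⟩)

theorem nf2 (i k p : ℕ) : e i * ((X * Y) ^ k * Y ^ p) ∈ Submodule.span ℂ (NF n e X Y b) :=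
  Submodule.subset_span (Or.inr (Or.inl ⟨i, k, p, by rw [mul_assoc]⟩))

theorem nf3 (i k p q : ℕ) :
    e i * ((X * Y) ^ k * (Y ^ p * b * X ^ q)) ∈ Submodule.span ℂ (NF n e X Y b) :=
  Submodule.subset_span (Or.inr (Or.inr ⟨i, k, p, q, by rw [mul_assoc (e i)]⟩))

theorem nf_X (h : TAbs n e X Y b) (hn : 1 ≤ n) : ∀ x ∈ Submodule.span ℂ (NF n e X Y b),
    X * x ∈ Submodule.span ℂ (NF n e X Y b) := by
  refine nf_step fun x hx => ?_
  have mv : ∀ i k w, X * (e i * (X * Y)^k * w) = e (i+1) * ((X * Y)^k * (X * w)) := by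
    intro i k w
    rw [mul_assoc (e i), ← mul_assoc X, ← h.hX, mul_assoc (e _), ← mul_assoc X,
      ← ((h.zX hn).pow_left k).eq, mul_assoc (_ ^ _)]
  rcases hx with ⟨i, k, p, rfl⟩ | ⟨i, k, p, rfl⟩ | ⟨i, k, p, q, rfl⟩
  · rw [mv, ← pow_succ']; exact nf1 _ _ _
  · rw [mv]
    cases p with
    | zero => simpa using nf1 (n := n) (e := e) (b := b) (X := X) (Y := Y) (i+1) k 1
    | succ p =>
      rw [pow_succ', ← mul_assoc X, ← mul_assoc (_ ^ k), ← pow_succ]; exact nf2 _ _ _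
  · rw [mv]
    cases p with
    | zero => rw [pow_zero, one_mul, ← mul_assoc X, h.Xb hn]; simp
    | succ p =>
      have : X * (Y ^ (p+1) * b * X ^ q) = (X * Y) * (Y ^ p * b * X ^ q) := by
        rw [pow_succ']; simp only [mul_assoc]
      rw [this, ← mul_assoc (_ ^ k), ← pow_succ]; exact nf3 _ _ _ _

theorem nf_b (h : TAbs n e X Y b) (hn : 1 ≤ n) : ∀ x ∈ Submodule.span ℂ (NF n e X Y b),
    b * x ∈ Submodule.span ℂ (NF n e X Y b) := by
  refine nf_step fun x hx => ?_
  have mv : ∀ i k w, e (n-1) * ((X * Y)^k * (b * w)) ∈ Submodule.span ℂ (NF n e X Y b) →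
      b * (e i * (X * Y)^k * w) ∈ Submodule.span ℂ (NF n e X Y b) := by
    intro i k w hw
    rw [mul_assoc (e i), ← mul_assoc b, h.hb]
    split_ifs
    · rwa [← mul_assoc (_^k), ((h.zb hn).pow_left k).eq, mul_assoc b, ← mul_assoc (e _),
        (h.last hn).2] at hw
    · simp
  rcases hx with ⟨i, k, p, rfl⟩ | ⟨i, k, p, rfl⟩ | ⟨i, k, p, q, rfl⟩
  · apply mv; simpa using nf3 (n := n) (e := e) (b := b) (X := X) (Y := Y) (n-1) k 0 p
  · apply mv
    cases p with
    | zero => simpa using nf3 (n := n) (e := e) (b := b) (X := X) (Y := Y) (n-1) k 0 0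
    | succ p => rw [pow_succ', ← mul_assoc b, h.bY hn]; simp
  · apply mv
    cases p with
    | zero =>
      rw [pow_zero, one_mul, ← mul_assoc b, h.bb hn, ← (h.ze _).eq, mul_assoc,
        ← mul_assoc (_ ^ k), ← pow_succ, ← mul_assoc (_ ^ _), ((h.ze _).pow_left _).eq,
        mul_assoc (e _)]
      exact h.nf_e _ _ (nf1 _ _ _)
    | succ p => rw [pow_succ', mul_assoc Y, mul_assoc Y, ← mul_assoc b, h.bY hn]; simp

theorem nf_Y (h : TAbs n e X Y b) (hn : 1 ≤ n) : ∀ x ∈ Submodule.span ℂ (NF n e X Y b),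
    Y * x ∈ Submodule.span ℂ (NF n e X Y b) := by
  refine nf_step fun x hx => ?_
  have mv : ∀ i k w, (∀ i, e i * ((X * Y)^k * (Y * w)) ∈ Submodule.span ℂ (NF n e X Y b)) →
      Y * (e i * (X * Y)^k * w) ∈ Submodule.span ℂ (NF n e X Y b) := by
    intro i k w hw
    rw [mul_assoc (e i), ← mul_assoc Y]
    cases i with
    | zero => rw [h.hY0]; simp
    | succ i =>
      rw [h.hY, mul_assoc (e i), ← mul_assoc Y, ← ((h.zY hn).pow_left k).eq, mul_assoc (_ ^ k)]
      exact hw i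
  rcases hx with ⟨i, k, p, rfl⟩ | ⟨i, k, p, rfl⟩ | ⟨i, k, p, q, rfl⟩
  · apply mv
    intro i
    cases p with
    | zero => simpa using nf2 (n := n) (e := e) (b := b) (X := X) (Y := Y) i k 1
    | succ p =>
      rw [pow_succ', ← mul_assoc Y, h.YX, sub_mul, mul_sub, mul_sub]
      refine Submodule.sub_mem _ ?_ ?_
      · rw [← mul_assoc (_ ^ k), ← pow_succ]; exact nf1 _ _ _
      · rw [h.bb hn, ← (h.ze _).eq, mul_assoc,
          ← mul_assoc (_ ^ k), ← pow_succ, ← mul_assoc (_ ^ _), ((h.ze _).pow_left _).eq,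
          mul_assoc (e _)]
        exact h.nf_e _ _ (nf1 _ _ _)
  · apply mv
    intro i
    rw [← pow_succ']; exact nf2 _ _ _
  · apply mv
    intro i
    rw [← mul_assoc Y, ← mul_assoc Y, ← pow_succ']; exact nf3 _ _ _ _

theorem nf_one (h : TAbs n e X Y b) : 1 ∈ Submodule.span ℂ (NF n e X Y b) := by
  rw [← h.hs]
  refine Submodule.sum_mem _ fun i _ => ?_
  simpa using nf1 (n := n) (e := e) (b := b) (X := X) (Y := Y) i 0 0

section
variable {T : Submodule ℂ A}

theorem nf_le (h : TAbs n e X Y b) (hn : 1 ≤ n) (hC : ∀ x y : A, x * y - y * x ∈ T)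
    (he : ∀ i < n, e i ∈ T) (hodd : ∀ k < n, b ^ (2*k+1) ∈ T) :
    Submodule.span ℂ (NF n e X Y b) ≤ T := by
  have cyc : ∀ x y : A, y * x ∈ T → x * y ∈ T := by
    intro x y hxy
    have := T.add_mem (hC x y) hxy
    simpa using this
  have he' : ∀ i, e i ∈ T := by
    intro i
    by_cases hi : i < n
    · exact he i hi
    · rw [h.hen i (by omega)]; exact T.zero_mem
  have hbz : ∀ k, b * (X * Y) ^ k ∈ T := by
    intro k
    by_cases hk : k < n
    · rw [← h.bodd hn]; exact hodd k hk
    · obtain ⟨m, rfl⟩ : ∃ m, k = n + m := ⟨k - n, by omega⟩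
      rw [pow_add, h.zn hn]; simp
  -- powers of z
  have hz : ∀ k i, e i * (X * Y) ^ (k+1) ∈ T := by
    intro k i
    induction i with
    | zero => rw [pow_succ', ← mul_assoc, h.z0]; simp
    | succ i ih =>
      by_cases hi : n ≤ i + 1
      · rw [h.hen _ hi]; simp
      · have e1 : e (i+1) * (X * Y) ^ (k+1) = X * (e i * Y * (X*Y)^k) := by
          rw [pow_succ', ← mul_assoc, ← mul_assoc, h.hX]; simp only [mul_assoc]
        rw [e1]
        apply cyc
        have e2 : e i * Y * (X * Y) ^ k * X = e i * (X * Y) ^ (k+1) := by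
          rw [mul_assoc, ((h.zX hn).pow_left k).eq, ← mul_assoc, mul_assoc (e i), h.YX, mul_sub,
            ← mul_assoc (e i) b, h.hb', if_neg (by omega), zero_mul, sub_zero, mul_assoc, pow_succ']
        rw [e2]; exact ih
  have hXp : ∀ k p i, e i * (X * Y) ^ k * X ^ (p+1) ∈ T := by
    intro k p i
    induction i with
    | zero => rw [← ((h.ze 0).pow_left k).eq, pow_succ', mul_assoc, ← mul_assoc (e 0), h.hX0]; simp
    | succ i ih =>
      have e1 : e (i+1) * (X * Y) ^ k * X ^ (p+1) = X * (e i * (X*Y)^k * X ^ p) := by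
        rw [pow_succ', ← mul_assoc, mul_assoc (e _), ((h.zX hn).pow_left k).eq, ← mul_assoc, h.hX]
        simp only [mul_assoc]
      rw [e1]
      apply cyc
      rw [mul_assoc, ← pow_succ]; exact ih
  have hYp : ∀ k p m i, n ≤ i + m → e i * (X * Y) ^ k * Y ^ (p+1) ∈ T := by
    intro k p m
    induction m with
    | zero => intro i hi; rw [h.hen _ (by omega)]; simp
    | succ m ih =>
      intro i hi
      have e1 : e i * (X * Y) ^ k * Y ^ (p+1) = Y * (e (i+1) * (X*Y)^k * Y ^ p) := by
        rw [pow_succ', ← mul_assoc, mul_assoc (e _), ((h.zY hn).pow_left k).eq, ← mul_assoc, ← h.hY]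
        simp only [mul_assoc]
      rw [e1]
      apply cyc
      rw [mul_assoc, ← pow_succ]; exact ih _ (by omega)
  -- elements through b
  have hYe : ∀ p i, e i * Y ^ p = Y ^ p * e (i + p) := by
    intro p
    induction p with
    | zero => simp
    | succ p ih =>
      intro i
      rw [pow_succ', ← mul_assoc, ← h.hY, mul_assoc, ih, ← mul_assoc]
      congr 2; omega
  have hXe : ∀ p i, X ^ p * e i = e (i + p) * X ^ p := by
    intro p
    induction p with
    | zero => simp
    | succ p ih =>
      intro i
      rw [pow_succ, mul_assoc, ← h.hX, ← mul_assoc, ih, mul_assoc]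
      congr 2; omega
  have hbX : ∀ k m j, b * X ^ m * (X * Y) ^ k * e j ∈ T := by
    intro k m j
    have e1 : b * X ^ m * (X * Y) ^ k * e j = (b * e (j+m)) * (X ^ m * (X * Y) ^ k) := by
      rw [mul_assoc, ((h.ze j).pow_left k).eq, ← mul_assoc, mul_assoc b, hXe]
      simp only [mul_assoc]
    rw [e1, h.hb]
    split_ifs
    · cases m with
      | zero => simpa using hbz k
      | succ m =>
        apply cyc
        rw [mul_assoc, ((h.zb hn).pow_left k).eq, pow_succ, mul_assoc, ← mul_assoc X, h.Xb hn]; simp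
    · simp
  refine Submodule.span_le.2 ?_
  rintro x (⟨i, k, p, rfl⟩ | ⟨i, k, p, rfl⟩ | ⟨i, k, p, q, rfl⟩)
  · cases p with
    | zero =>
      cases k with
      | zero => simpa using he' i
      | succ k => simpa using hz k i
    | succ p => exact hXp k p i
  · cases p with
    | zero =>
      cases k with
      | zero => simpa using he' i
      | succ k => simpa using hz k i
    | succ p => exact hYp k p n i (by omega)
  · show _ ∈ T
    have e1 : e i * (X * Y) ^ k * (Y ^ p * b * X ^ q)
        = ((X * Y) ^ k * (e i * Y ^ p)) * (b * X ^ q) := by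
      rw [← ((h.ze i).pow_left k).eq]; simp only [mul_assoc]
    rw [e1, hYe]
    apply cyc
    have e2 : b * X ^ q * ((X * Y) ^ k * (Y ^ p * e (i+p)))
        = b * (X ^ q * Y ^ p) * (X * Y) ^ k * e (i+p) := by
      rw [← mul_assoc (_ ^ k), ((h.zY hn).pow_pow k p).eq]; simp only [mul_assoc]
    rw [e2]
    rcases le_or_gt p q with hpq | hpq
    · obtain ⟨m, rfl⟩ := Nat.exists_eq_add_of_le hpq
      rw [add_comm p m, pow_add, mul_assoc (X ^ m), h.XpYp hn, ← mul_assoc, mul_assoc _ (_ ^ p),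
        ← pow_add]
      exact hbX _ _ _
    · obtain ⟨m, rfl⟩ := Nat.exists_eq_add_of_lt hpq
      rw [show q + m + 1 = q + (m + 1) by ring, pow_add, ← mul_assoc (X ^ q), h.XpYp hn,
        ← mul_assoc b, ← ((h.zb hn).pow_left q).eq, pow_succ', mul_assoc _ b, ← mul_assoc b,
        h.bY hn]
      simp

end

end TAbs

namespace TPre

/-! ### The relations in `PiT n` -/

/-- Vertex idempotents indexed by `ℕ`. -/
noncomputable def ee (n : ℕ) (k : ℕ) : PiT n := if h : k < n then gen (TGen.e ⟨k, h⟩) else 0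

theorem ee_fin {n : ℕ} (i : Fin n) : ee n i = gen (TGen.e i) := by simp [ee]

theorem ee_mul (n i j : ℕ) : ee n i * ee n j = if i = j then ee n i else 0 := by
  unfold ee
  by_cases hi : i < n
  · by_cases hj : j < n
    · have := RingQuot.mkAlgHom_rel ℂ (TRel.idem (n := n) ⟨i, hi⟩ ⟨j, hj⟩)
      rw [map_mul] at this
      simp only [hi, hj, dif_pos]
      rw [show gen (TGen.e ⟨i, hi⟩) * gen (TGen.e ⟨j, hj⟩) = _ from this]
      by_cases hij : i = j
      · simp [hij, gen]
      · simp [hij]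
    · have : i ≠ j := by omega
      simp [hj, this]
  · simp [hi]

theorem a_eq {n : ℕ} (j : Fin n) : ee n (j+1) * gen (.a j) * ee n j = (gen (.a j) : PiT n) := by
  by_cases h : (j : ℕ) + 1 < n
  · have := RingQuot.mkAlgHom_rel ℂ (TRel.a_path (n := n) j h)
    rw [map_mul, map_mul] at this
    simpa [ee, h, gen] using this
  · have := RingQuot.mkAlgHom_rel ℂ (TRel.a_junk (n := n) j h)
    rw [map_zero] at this
    rw [show gen (.a j) = (0 : PiT n) from this]; simp

theorem astar_eq {n : ℕ} (j : Fin n) :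
    ee n j * gen (.astar j) * ee n (j+1) = (gen (.astar j) : PiT n) := by
  by_cases h : (j : ℕ) + 1 < n
  · have := RingQuot.mkAlgHom_rel ℂ (TRel.astar_path (n := n) j h)
    rw [map_mul, map_mul] at this
    simpa [ee, h, gen] using this
  · have := RingQuot.mkAlgHom_rel ℂ (TRel.astar_junk (n := n) j h)
    rw [map_zero] at this
    rw [show gen (.astar j) = (0 : PiT n) from this]; simp

theorem b_eq {n : ℕ} (hn : 1 ≤ n) :
    ee n (n-1) * gen .b * ee n (n-1) = (gen .b : PiT n) := by
  have := RingQuot.mkAlgHom_rel ℂ (TRel.b_path (n := n) ⟨n-1, by omega⟩ (by simp; omega))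
  rw [map_mul, map_mul] at this
  have h : n - 1 < n := by omega
  simpa [ee, h, gen] using this

theorem left_of {n : ℕ} {x : PiT n} {p q : ℕ} (h : ee n p * x * ee n q = x) (k : ℕ) :
    ee n k * x = if k = p then x else 0 := by
  rw [← h, ← mul_assoc, ← mul_assoc, ee_mul]
  split_ifs with hk
  · rw [hk]
  · simp

theorem right_of {n : ℕ} {x : PiT n} {p q : ℕ} (h : ee n p * x * ee n q = x) (k : ℕ) :
    x * ee n k = if q = k then x else 0 := by
  rw [← h, mul_assoc, ee_mul]
  split_ifs with hk
  · rfl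
  · simp

theorem mul_of {n : ℕ} {x y : PiT n} {p q p' q' : ℕ} (h : ee n p * x * ee n q = x)
    (h' : ee n p' * y * ee n q' = y) (hne : q ≠ p') : x * y = 0 := by
  rw [← h', ← mul_assoc, ← mul_assoc, right_of h, if_neg hne]; simp

theorem tabs (n : ℕ) (hn : 1 ≤ n) : TAbs n (ee n) (∑ j : Fin n, gen (.a j))
    (∑ j : Fin n, gen (.astar j)) (gen .b) where
  hX0 := by
    rw [Finset.mul_sum]
    exact Finset.sum_eq_zero fun j _ => by rw [left_of (a_eq j), if_neg (by omega)]
  hX i := by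
    rw [Finset.mul_sum, Finset.sum_mul]
    refine Finset.sum_congr rfl fun j _ => ?_
    rw [left_of (a_eq j), right_of (a_eq j)]
    simp [eq_comm]
  hY0 := by
    rw [Finset.sum_mul]
    exact Finset.sum_eq_zero fun j _ => by rw [right_of (astar_eq j), if_neg (by omega)]
  hY i := by
    rw [Finset.mul_sum, Finset.sum_mul]
    refine Finset.sum_congr rfl fun j _ => ?_
    rw [left_of (astar_eq j), right_of (astar_eq j)]
    simp [eq_comm]
  hb i := by
    rw [right_of (b_eq hn)]
    congr 1
    apply propext; omega
  hb' i := by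
    rw [left_of (b_eq hn)]
    congr 1
    apply propext; omega
  hee := ee_mul n
  hen i hi := by simp [ee, hi]
  hs := by
    rw [Finset.sum_range]
    simp only [ee_fin]
    have := RingQuot.mkAlgHom_rel ℂ (TRel.sum_idem (n := n))
    rwa [map_sum, map_one] at this
  hp := by
    have := RingQuot.mkAlgHom_rel ℂ (TRel.preproj (n := n))
    rw [map_sum, map_mul] at this
    rw [show gen .b * gen .b = _ from this.symm, Finset.sum_mul_sum, Finset.sum_mul_sum,
      ← Finset.sum_sub_distrib]
    refine Finset.sum_congr rfl fun i _ => ?_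
    rw [map_sub, map_mul, map_mul]
    congr 1
    · rw [Finset.sum_eq_single i]
      · rfl
      · intro j _ hj
        exact mul_of (a_eq i) (astar_eq j) fun h => hj (Fin.ext h.symm)
      · simp
    · rw [Finset.sum_eq_single i]
      · rfl
      · intro j _ hj
        exact mul_of (astar_eq i) (a_eq j) fun h => hj (Fin.ext (by omega))
      · simp

theorem a_eq' {n : ℕ} (j : Fin n) :
    (gen (.a j) : PiT n) = (∑ i : Fin n, gen (.a i)) * ee n j := by
  rw [Finset.sum_mul, Finset.sum_eq_single j]
  · rw [right_of (a_eq j), if_pos rfl]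
  · intro i _ hi
    rw [right_of (a_eq i), if_neg fun h => hi (Fin.ext h)]
  · simp

theorem astar_eq' {n : ℕ} (j : Fin n) :
    (gen (.astar j) : PiT n) = (∑ i : Fin n, gen (.astar i)) * ee n (j+1) := by
  rw [Finset.sum_mul, Finset.sum_eq_single j]
  · rw [right_of (astar_eq j), if_pos rfl]
  · intro i _ hi
    rw [right_of (astar_eq i), if_neg fun h => hi (Fin.ext (by omega))]
  · simp

theorem span_top (n : ℕ) (hn : 1 ≤ n) (T : Submodule ℂ (PiT n))
    (hC : ∀ x y : PiT n, x * y - y * x ∈ T)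
    (he : ∀ i : Fin n, gen (.e i) ∈ T) (hodd : ∀ k : Fin n, (gen .b) ^ (2*(k : ℕ)+1) ∈ T) (x : PiT n) :
    x ∈ T := by
  have h := tabs n hn
  refine h.nf_le hn hC (fun i hi => by simpa [ee, hi] using he ⟨i, hi⟩)
    (fun k hk => hodd ⟨k, hk⟩) ?_
  set S := Submodule.span ℂ (TAbs.NF n (ee n) (∑ j : Fin n, gen (.a j))
    (∑ j : Fin n, gen (.astar j)) (gen .b)) with hS
  obtain ⟨p, rfl⟩ := RingQuot.mkAlgHom_surjective ℂ (TRel n) x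
  have key : ∀ p : F n, ∀ y ∈ S, RingQuot.mkAlgHom ℂ (TRel n) p * y ∈ S := by
    intro p
    induction p using FreeAlgebra.induction with
    | grade0 r =>
      intro y hy
      rw [AlgHom.commutes, ← Algebra.smul_def]
      exact S.smul_mem _ hy
    | grade1 v =>
      intro y hy
      change gen v * y ∈ S
      cases v with
      | e i => rw [← ee_fin]; exact h.nf_e _ _ hy
      | a i => rw [a_eq', mul_assoc]; exact h.nf_X hn _ (h.nf_e _ _ hy)
      | astar i => rw [astar_eq', mul_assoc]; exact h.nf_Y hn _ (h.nf_e _ _ hy)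
      | b => exact h.nf_b hn _ hy
    | mul p q hp hq =>
      intro y hy
      rw [map_mul, mul_assoc]
      exact hp _ (hq _ hy)
    | add p q hp hq =>
      intro y hy
      rw [map_add, add_mul]
      exact S.add_mem (hp _ hy) (hq _ hy)
  simpa using key p 1 h.nf_one

/-! ### The trace functionals -/

theorem descend {B : Type*} [Ring B] [Algebra ℂ B] (r : B → B → Prop) (φ : B →ₗ[ℂ] ℂ)
    (h : ∀ x y, r x y → ∀ p q, φ (p * (x - y) * q) = 0) :
    ∃ ψ : RingQuot r →ₗ[ℂ] ℂ, ∀ x, ψ (RingQuot.mkAlgHom ℂ r x) = φ x := by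
  let c : RingCon B :=
    { r := fun x y => ∀ p q, φ (p * (x - y) * q) = 0
      iseqv := ⟨fun x p q => by simp,
        fun {x y} hxy p q => by
          rw [← neg_sub, mul_neg, neg_mul, map_neg, hxy, neg_zero],
        fun {x y z} hxy hyz p q => by
          rw [← sub_add_sub_cancel x y z, mul_add, add_mul, map_add, hxy, hyz, add_zero]⟩
      add' := fun {w x y z} h1 h2 p q => by
        rw [add_sub_add_comm, mul_add, add_mul, map_add, h1, h2, add_zero]
      mul' := fun {w x y z} h1 h2 p q => by
        have : p * (w * y - x * z) * q = p * (w - x) * (y * q) + (p * x) * (y - z) * q := by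
          noncomm_ring
        rw [this, map_add, h1, h2, add_zero] }
  let f : RingQuot r →+* c.Quotient := RingQuot.lift ⟨c.mk', fun x y hxy => by
    exact (RingCon.eq c).2 (h x y hxy)⟩
  have hf : ∀ x, f (RingQuot.mkAlgHom ℂ r x) = c.mk' x := by
    intro x
    have : RingQuot.mkAlgHom ℂ r x = RingQuot.mkRingHom r x := by
      rw [← RingQuot.mkAlgHom_coe ℂ r]; rfl
    rw [this]
    exact RingQuot.lift_mkRingHom_apply _ _ _
  have hk : LinearMap.ker (RingQuot.mkAlgHom ℂ r).toLinearMap ≤ LinearMap.ker φ := by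
    intro x hx
    have hx' : RingQuot.mkAlgHom ℂ r x = 0 := hx
    have h2 := hf x
    rw [hx', map_zero, ← map_zero c.mk'] at h2
    have h3 : c x 0 := ((RingCon.eq c).1 h2.symm)
    have := h3 1 1
    simpa using this
  refine ⟨(Submodule.liftQ _ φ hk) ∘ₗ ((RingQuot.mkAlgHom ℂ r).toLinearMap.quotKerEquivOfSurjective
    (RingQuot.mkAlgHom_surjective ℂ r)).symm.toLinearMap, fun x => ?_⟩
  have : ((RingQuot.mkAlgHom ℂ r).toLinearMap.quotKerEquivOfSurjective
    (RingQuot.mkAlgHom_surjective ℂ r)).symm (RingQuot.mkAlgHom ℂ r x) = Submodule.Quotient.mk x := by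
    rw [LinearEquiv.symm_apply_eq]; rfl
  simp only [LinearMap.comp_apply, LinearEquiv.coe_coe]
  rw [this]; rfl

open Polynomial in
/-- Matrix unit with natural number indices (zero if out of range). -/
noncomputable def U (n : ℕ) (p q : ℕ) (f : ℂ[X]) : Matrix (Fin n) (Fin n) ℂ[X] :=
  Matrix.of fun i j => if (i : ℕ) = p ∧ (j : ℕ) = q then f else 0

open Polynomial in
theorem U_mul (n p q r s : ℕ) (f g : ℂ[X]) :
    U n p q f * U n r s g = if q = r ∧ q < n then U n p s (f * g) else 0 := by
  ext1 i j
  rw [Matrix.mul_apply]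
  split_ifs with h
  · obtain ⟨rfl, h⟩ := h
    rw [Finset.sum_eq_single ⟨q, h⟩]
    · simp only [U, Matrix.of_apply]
      by_cases h1 : (i : ℕ) = p <;> by_cases h2 : (j : ℕ) = s <;> simp [h1, h2]
    · intro k _ hk
      have : (k : ℕ) ≠ q := fun h => hk (Fin.ext h)
      simp [U, this]
    · simp
  · refine Finset.sum_eq_zero fun k _ => ?_
    simp only [U, Matrix.of_apply]
    by_cases h1 : (k : ℕ) = q
    · have : (k : ℕ) ≠ r := by have := k.2; omega
      simp [this]
    · simp [h1]

open Polynomial in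
theorem U_zero (n p q : ℕ) (f : ℂ[X]) (h : n ≤ p ∨ n ≤ q) : U n p q f = 0 := by
  ext1 i j
  have : ¬ ((i : ℕ) = p ∧ (j : ℕ) = q) := by have := i.2; have := j.2; omega
  simp [U, this]

open Polynomial in
/-- Images of the generators. -/
noncomputable def rhoGen (n : ℕ) : TGen n → Matrix (Fin n) (Fin n) ℂ[X]
  | .e i => U n i i 1
  | .a i => U n (i+1) i X
  | .astar i => U n i (i+1) X
  | .b => U n (n-1) (n-1) X

open Polynomial in
/-- The representation of the free algebra. -/
noncomputable def rho (n : ℕ) : F n →ₐ[ℂ] Matrix (Fin n) (Fin n) ℂ[X] :=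
  FreeAlgebra.lift ℂ (rhoGen n)

theorem rho_g {n : ℕ} (x : TGen n) : rho n (g x) = rhoGen n x := by
  simp [rho, g]

open Polynomial in
/-- Degree constraints satisfied by the image of `rho`. -/
def Good (n : ℕ) (M : Matrix (Fin n) (Fin n) ℂ[X]) : Prop :=
  ∀ (i j : Fin n) (d : ℕ), (M i j).coeff d ≠ 0 →
    ((d + i + j) % 2 = 0 ∧ (i : ℕ) ≤ j + d ∧ (j : ℕ) ≤ i + d) ∨
    ((d + i + j) % 2 = 1 ∧ 2 * n ≤ d + i + j + 1)

open Polynomial in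
theorem good_U_one (n i : ℕ) : Good n (U n i i 1) := by
  intro p q d h
  simp only [U, Matrix.of_apply] at h
  split_ifs at h with hpq
  · rw [coeff_one] at h
    have : d = 0 := by by_contra h'; simp [h'] at h
    left; omega
  · simp at h

open Polynomial in
theorem good_U_X (n i j : ℕ) (hij : i = j + 1 ∨ j = i + 1 ∨ (i + 1 = n ∧ j + 1 = n)) :
    Good n (U n i j X) := by
  intro p q d h
  simp only [U, Matrix.of_apply] at h
  split_ifs at h with hpq
  · rw [coeff_X] at h
    have : 1 = d := by by_contra h'; simp [h'] at h
    omega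
  · simp at h

open Polynomial in
theorem good_mul {n : ℕ} {M N : Matrix (Fin n) (Fin n) ℂ[X]} (hM : Good n M) (hN : Good n N) :
    Good n (M * N) := by
  intro i k d h
  rw [Matrix.mul_apply, finsetSum_coeff] at h
  obtain ⟨j, _, hj⟩ := Finset.exists_ne_zero_of_sum_ne_zero h
  rw [coeff_mul] at hj
  obtain ⟨⟨d1, d2⟩, hd, hj⟩ := Finset.exists_ne_zero_of_sum_ne_zero hj
  rw [Finset.HasAntidiagonal.mem_antidiagonal] at hd
  have h1 := hM i j d1 (left_ne_zero_of_mul hj)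
  have h2 := hN j k d2 (right_ne_zero_of_mul hj)
  have := i.2
  have := j.2
  have := k.2
  simp only at hd
  omega

open Polynomial in
theorem good_add {n : ℕ} {M N : Matrix (Fin n) (Fin n) ℂ[X]} (hM : Good n M) (hN : Good n N) :
    Good n (M + N) := by
  intro i k d h
  rw [Matrix.add_apply, coeff_add] at h
  by_cases h1 : (M i k).coeff d = 0
  · exact hN i k d (by simpa [h1] using h)
  · exact hM i k d h1

theorem good_rho {n : ℕ} (hn : 1 ≤ n) (x : F n) : Good n (rho n x) := by
  induction x using FreeAlgebra.induction with
  | grade0 r =>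
    intro i j d h
    rw [AlgHom.commutes, Matrix.algebraMap_matrix_apply] at h
    split_ifs at h with hij
    · rw [Polynomial.algebraMap_apply, Polynomial.coeff_C] at h
      have : d = 0 := by by_contra h'; simp [h'] at h
      subst hij
      left; omega
    · simp at h
  | grade1 v =>
    change Good n (rho n (g v))
    rw [rho_g]
    cases v with
    | e i => exact good_U_one _ _
    | a i => exact good_U_X _ _ _ (by omega)
    | astar i => exact good_U_X _ _ _ (by omega)
    | b => exact good_U_X _ _ _ (by omega)
  | mul p q hp hq => rw [map_mul]; exact good_mul hp hq
  | add p q hp hq => rw [map_add]; exact good_add hp hq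

open Polynomial in
/-- Coefficient of the trace. -/
noncomputable def phi (n k : ℕ) : F n →ₗ[ℂ] ℂ :=
  (lcoeff ℂ (2*k+1) ∘ₗ Matrix.traceLinearMap (Fin n) ℂ ℂ[X]) ∘ₗ (rho n).toLinearMap

theorem phi_apply (n k : ℕ) (x : F n) :
    phi n k x = ((rho n x).trace).coeff (2*k+1) := rfl

open Polynomial in
theorem sum_U (n : ℕ) : ∑ i ∈ Finset.range n, U n i i 1 = 1 := by
  ext1 p q
  rw [Matrix.sum_apply, Finset.sum_eq_single (p : ℕ)]
  · by_cases h : p = q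
    · subst h; simp [U]
    · have : (q : ℕ) ≠ p := fun h' => h (Fin.ext h'.symm)
      simp [U, h, this]
  · intro i _ hi
    simp [U, hi.symm]
  · simp

open Polynomial in
theorem telescoping (n : ℕ) (hn : 1 ≤ n) :
    ∑ i ∈ Finset.range n, (U n (i+1) (i+1) (X * X) - if i + 1 < n then U n i i (X * X) else 0)
      = U n (n-1) (n-1) (X * X) - U n 0 0 (X * X) := by
  obtain ⟨m, rfl⟩ : ∃ m, n = m + 1 := ⟨n - 1, by omega⟩
  rw [Finset.sum_range_succ, U_zero _ (m+1) _ _ (by omega), if_neg (by omega), sub_zero, add_zero]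
  rw [show m + 1 - 1 = m from rfl, ← Finset.sum_range_sub (fun i => U (m+1) i i (X * X))]
  refine Finset.sum_congr rfl fun i hi => ?_
  rw [Finset.mem_range] at hi
  rw [if_pos (by omega)]

open Polynomial in
theorem rho_rel {n : ℕ} (hn : 1 ≤ n) {x y : F n} (h : TRel n x y) :
    rho n (x - y) = 0 ∨ rho n (x - y) = - U n 0 0 (X * X) := by
  cases h with
  | idem i j =>
    left
    rw [map_sub, map_mul, rho_g, rho_g, sub_eq_zero]
    simp only [rhoGen, U_mul]
    by_cases h : i = j
    · subst h; simp [rho_g, rhoGen]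
    · have : (i : ℕ) ≠ j := fun h' => h (Fin.ext h')
      simp [h, this]
  | sum_idem =>
    left
    rw [map_sub, map_sum, sub_eq_zero, map_one]
    simp only [rho_g, rhoGen]
    rw [← Finset.sum_range (fun i => U n i i 1)]
    exact sum_U n
  | a_path i h =>
    left
    rw [map_sub, map_mul, map_mul, sub_eq_zero]
    simp only [rho_g, rhoGen]
    simp [U_mul, h]
  | a_junk i h =>
    left
    rw [sub_zero, rho_g]
    exact U_zero _ _ _ _ (by omega)
  | astar_path i h =>
    left
    rw [map_sub, map_mul, map_mul, sub_eq_zero]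
    simp only [rho_g, rhoGen]
    simp [U_mul, h]
  | astar_junk i h =>
    left
    rw [sub_zero, rho_g]
    exact U_zero _ _ _ _ (by omega)
  | b_path i h =>
    left
    have hi : (i : ℕ) = n - 1 := by omega
    have : n - 1 < n := by omega
    rw [map_sub, map_mul, map_mul, sub_eq_zero]
    simp only [rho_g, rhoGen, hi]
    simp [U_mul, this]
  | preproj =>
    right
    have : n - 1 < n := by omega
    rw [map_sub, map_sum, map_mul]
    simp only [map_sub, map_mul, rho_g, rhoGen, U_mul, this, Fin.is_lt, and_true, if_true, true_and]
    rw [← Finset.sum_range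
      (fun i => U n (i+1) (i+1) (X * X) - if i + 1 < n then U n i i (X * X) else 0),
      telescoping n hn]
    abel

open Polynomial in
theorem trace_U_zero (n : ℕ) (hn : 1 ≤ n) (f : ℂ[X]) (M : Matrix (Fin n) (Fin n) ℂ[X]) :
    (U n 0 0 f * M).trace = f * M ⟨0, hn⟩ ⟨0, hn⟩ := by
  rw [Matrix.trace, Finset.sum_eq_single ⟨0, hn⟩]
  · rw [Matrix.diag_apply, Matrix.mul_apply, Finset.sum_eq_single ⟨0, hn⟩]
    · simp [U]
    · intro j _ hj
      have : (j : ℕ) ≠ 0 := fun h => hj (Fin.ext h)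
      simp [U, this]
    · simp
  · intro j _ hj
    have : (j : ℕ) ≠ 0 := fun h => hj (Fin.ext h)
    rw [Matrix.diag_apply, Matrix.mul_apply]
    exact Finset.sum_eq_zero fun i _ => by simp [U, this]
  · simp

open Polynomial in
theorem phi_rel {n : ℕ} (hn : 1 ≤ n) (k : ℕ) (hk : k < n) {x y : F n} (h : TRel n x y)
    (p q : F n) : phi n k (p * (x - y) * q) = 0 := by
  rw [phi_apply, map_mul, map_mul]
  rcases rho_rel hn h with h | h
  · rw [h]; simp
  · rw [h, mul_assoc, Matrix.trace_mul_comm, mul_assoc, ← map_mul, neg_mul, Matrix.trace_neg,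
      trace_U_zero n hn, coeff_neg, neg_eq_zero, mul_assoc]
    cases k with
    | zero => rw [mul_comm, mul_assoc]; simp
    | succ k =>
      rw [show 2 * (k+1) + 1 = (2*k+1) + 1 + 1 by ring, coeff_X_mul, coeff_X_mul]
      by_contra hne
      have := good_rho hn _ _ _ _ hne
      simp only at this
      omega

theorem exists_psi (n : ℕ) (hn : 1 ≤ n) (k : Fin n) : ∃ ψ : PiT n →ₗ[ℂ] ℂ,
    (∀ x y, ψ (x * y - y * x) = 0) ∧ (∀ i, ψ (gen (.e i)) = 0) ∧
    ∀ j : Fin n, ψ (gen .b ^ (2 * (j : ℕ) + 1)) = if k = j then 1 else 0 := by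
  obtain ⟨ψ, hψ⟩ := descend (TRel n) (phi n k) (fun x y h p q => phi_rel hn k k.2 h p q)
  refine ⟨ψ, ?_, ?_, ?_⟩
  · intro x y
    obtain ⟨x, rfl⟩ := RingQuot.mkAlgHom_surjective ℂ (TRel n) x
    obtain ⟨y, rfl⟩ := RingQuot.mkAlgHom_surjective ℂ (TRel n) y
    rw [← map_mul, ← map_mul, ← map_sub, hψ, map_sub, phi_apply, phi_apply, map_mul, map_mul,
      Matrix.trace_mul_comm, sub_self]
  · intro i
    rw [gen, hψ, phi_apply, rho_g, rhoGen, Matrix.trace, Polynomial.finsetSum_coeff]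
    refine Finset.sum_eq_zero fun j _ => ?_
    simp only [U, Matrix.diag_apply, Matrix.of_apply]
    split_ifs
    · simp [Polynomial.coeff_one]
    · simp
  · intro j
    have hlt : n - 1 < n := by omega
    have hpow : ∀ m : ℕ, (U n (n-1) (n-1) Polynomial.X) ^ (m+1)
        = U n (n-1) (n-1) (Polynomial.X ^ (m+1)) := by
      intro m
      induction m with
      | zero => simp
      | succ m ih => rw [pow_succ, ih, U_mul, if_pos ⟨rfl, hlt⟩, ← pow_succ]
    rw [gen, ← map_pow, hψ, phi_apply, map_pow, rho_g, rhoGen, hpow, Matrix.trace,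
      Finset.sum_eq_single ⟨n-1, hlt⟩]
    · simp only [U, Matrix.diag_apply, Matrix.of_apply]
      rw [if_pos (by simp), Polynomial.coeff_X_pow]
      congr 1
      apply propext
      rw [Fin.ext_iff]; omega
    · intro i _ hi
      have : (i : ℕ) ≠ n - 1 := fun h => hi (Fin.ext h)
      simp [U, this]
    · simp

/-! ### The vertex functionals -/

theorem exists_chi (n : ℕ) (i : Fin n) : ∃ χ : PiT n →ₗ[ℂ] ℂ,
    (∀ x y, χ (x * y - y * x) = 0) ∧ (∀ j, χ (gen (.e j)) = if i = j then 1 else 0) ∧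
    ∀ j : Fin n, χ (gen .b ^ (2 * (j : ℕ) + 1)) = 0 := by
  let f : TGen n → ℂ := fun v => match v with
    | .e j => if i = j then 1 else 0
    | _ => 0
  have hf : ∀ v, FreeAlgebra.lift ℂ f (g v) = f v := fun v => by simp [g]
  let χ : PiT n →ₐ[ℂ] ℂ := RingQuot.liftAlgHom ℂ ⟨FreeAlgebra.lift ℂ f, by
    intro x y h
    cases h with
    | idem p q =>
      rw [map_mul, hf, hf]
      by_cases hpq : p = q
      · subst hpq; simp [hf, f]
      · rw [if_neg hpq, map_zero]
        simp only [f]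
        by_cases h1 : i = p
        · have : i ≠ q := fun h => hpq (h1.symm.trans h)
          simp [this]
        · simp [h1]
    | sum_idem => rw [map_sum, map_one]; simp [hf, f]
    | a_path p h => simp [hf, f]
    | a_junk p h => simp [hf, f]
    | astar_path p h => simp [hf, f]
    | astar_junk p h => simp [hf, f]
    | b_path p h => simp [hf, f]
    | preproj => simp [hf, f]⟩
  have hχ : ∀ v, χ (gen v) = f v := by
    intro v
    rw [← hf]
    exact RingQuot.liftAlgHom_mkAlgHom_apply _ _ _ _
  refine ⟨χ.toLinearMap, fun x y => ?_, fun j => ?_, fun j => ?_⟩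
  · change χ (x * y - y * x) = 0
    rw [map_sub, map_mul, map_mul, mul_comm, sub_self]
  · exact hχ _
  · change χ (gen .b ^ (2 * (j : ℕ) + 1)) = 0
    rw [map_pow, hχ]
    exact zero_pow (by omega)

end TPre

/-- **Theorem (`A/[A,A]`).**  For `A = Π_{T_n}`:
`A/[A,A] = R ⊕ span{bⁱ : i odd, 1 ≤ i ≤ 2n-1}`, i.e. the classes of the `n` vertex
idempotents together with the classes of the odd powers `b, b³, …, b^{2n-1}` of the loop
form a basis of `A/[A,A]`; in particular the odd powers of `b` give a basis of
`A/([A,A]+R)`, with one basis element in each odd degree `1, 3, …, 2n-1`. -/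
theorem quotient_by_commutators (n : ℕ) (hn : 1 ≤ n) :
    (LinearIndependent ℂ (abFamily n) ∧
      Submodule.span ℂ (Set.range (abFamily n)) = ⊤) ∧
    (LinearIndependent ℂ (abFamily' n) ∧
      Submodule.span ℂ (Set.range (abFamily' n)) = ⊤) := by
  choose ψ hψC hψe hψb using exists_psi n hn
  choose χ hχC hχe hχb using exists_chi n
  have mkC : ∀ x y : PiT n, x * y - y * x ∈ commSpan n := fun x y =>
    Submodule.subset_span ⟨x, y, rfl⟩
  refine ⟨⟨?_, ?_⟩, ?_, ?_⟩
  · let D0 : PiT n →ₗ[ℂ] (Fin n ⊕ Fin n → ℂ) := LinearMap.pi (Sum.elim χ ψ)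
    have hD0 : commSpan n ≤ LinearMap.ker D0 := by
      refine Submodule.span_le.2 ?_
      rintro _ ⟨y, z, rfl⟩
      refine LinearMap.mem_ker.2 (funext fun i => ?_)
      cases i with
      | inl i => exact hχC i y z
      | inr i => exact hψC i y z
    refine LinearIndependent.of_comp ((commSpan n).liftQ D0 hD0) ?_
    have : ((commSpan n).liftQ D0 hD0) ∘ abFamily n = fun i => Pi.single i (1 : ℂ) := by
      funext i j
      rcases i with i | i <;> rcases j with j | j
      · refine (hχe j i).trans ?_
        simp [Pi.single_apply]
      · refine (hψe j i).trans ?_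
        simp [Pi.single_apply]
      · refine (hχb j i).trans ?_
        simp [Pi.single_apply]
      · refine (hψb j i).trans ?_
        simp [Pi.single_apply]
    rw [this]
    exact Pi.linearIndependent_single_one _ _
  · rw [eq_top_iff]
    rintro q -
    obtain ⟨x, rfl⟩ := Submodule.mkQ_surjective _ q
    refine span_top n hn ((Submodule.span ℂ (Set.range (abFamily n))).comap (commSpan n).mkQ)
      ?_ ?_ ?_ x
    · intro x y
      rw [Submodule.mem_comap, Submodule.mkQ_apply, (Submodule.Quotient.mk_eq_zero _).2 (mkC x y)]
      exact Submodule.zero_mem _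
    · intro i
      exact Submodule.subset_span ⟨Sum.inl i, rfl⟩
    · intro i
      exact Submodule.subset_span ⟨Sum.inr i, rfl⟩
  · let D0 : PiT n →ₗ[ℂ] (Fin n → ℂ) := LinearMap.pi ψ
    have hD0 : commSpan n ⊔ Rspan n ≤ LinearMap.ker D0 := by
      refine sup_le (Submodule.span_le.2 ?_) (Submodule.span_le.2 ?_)
      · rintro _ ⟨y, z, rfl⟩
        exact LinearMap.mem_ker.2 (funext fun i => hψC i y z)
      · rintro _ ⟨j, rfl⟩
        exact LinearMap.mem_ker.2 (funext fun i => hψe i j)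
    refine LinearIndependent.of_comp ((commSpan n ⊔ Rspan n).liftQ D0 hD0) ?_
    have : ((commSpan n ⊔ Rspan n).liftQ D0 hD0) ∘ abFamily' n = fun i => Pi.single i (1 : ℂ) := by
      funext i j
      refine (hψb j i).trans ?_
      simp [Pi.single_apply]
    rw [this]
    exact Pi.linearIndependent_single_one _ _
  · rw [eq_top_iff]
    rintro q -
    obtain ⟨x, rfl⟩ := Submodule.mkQ_surjective _ q
    refine span_top n hn ((Submodule.span ℂ (Set.range (abFamily' n))).comap
      (commSpan n ⊔ Rspan n).mkQ) ?_ ?_ ?_ x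
    · intro x y
      rw [Submodule.mem_comap, Submodule.mkQ_apply, (Submodule.Quotient.mk_eq_zero _).2
        (Submodule.mem_sup_left (mkC x y))]
      exact Submodule.zero_mem _
    · intro i
      rw [Submodule.mem_comap, Submodule.mkQ_apply, (Submodule.Quotient.mk_eq_zero _).2
        (Submodule.mem_sup_right (show gen (.e i) ∈ Rspan n from Submodule.subset_span ⟨i, rfl⟩))]
      exact Submodule.zero_mem _
    · intro i
      exact Submodule.subset_span ⟨i, rfl⟩
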